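/- Let S(K²) denote the set of two-element subsets of G_K\M, on which M acts elementwise by right multiplication. Then the diagonal action of M on (G_L\M) × S(K²) has exactly seven orbits, and the multiset of orbit sizes is {960, 960, 960, 480, 480, 1920, 192}. -/

import Mathlib

open Matrix MulAction Pointwise

noncomputable section

namespace KLPaper

/-- The permutation matrix of the transposition (1 2), over `ℤ`. -/
def t12 : Matrix (Fin 7) (Fin 7) ℤ :=
  !![0,1,0,0,0,0,0; 1,0,0,0,0,0,0; 0,0,1,0,0,0,0; 0,0,0,1,0,0,0;
     0,0,0,0,1,0,0; 0,0,0,0,0,1,0; 0,0,0,0,0,0,1]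

def t23 : Matrix (Fin 7) (Fin 7) ℤ :=
  !![1,0,0,0,0,0,0; 0,0,1,0,0,0,0; 0,1,0,0,0,0,0; 0,0,0,1,0,0,0;
     0,0,0,0,1,0,0; 0,0,0,0,0,1,0; 0,0,0,0,0,0,1]

def t34 : Matrix (Fin 7) (Fin 7) ℤ :=
  !![1,0,0,0,0,0,0; 0,1,0,0,0,0,0; 0,0,0,1,0,0,0; 0,0,1,0,0,0,0;
     0,0,0,0,1,0,0; 0,0,0,0,0,1,0; 0,0,0,0,0,0,1]

def t56 : Matrix (Fin 7) (Fin 7) ℤ :=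
  !![1,0,0,0,0,0,0; 0,1,0,0,0,0,0; 0,0,1,0,0,0,0; 0,0,0,1,0,0,0;
     0,0,0,0,0,1,0; 0,0,0,0,1,0,0; 0,0,0,0,0,0,1]

def t67 : Matrix (Fin 7) (Fin 7) ℤ :=
  !![1,0,0,0,0,0,0; 0,1,0,0,0,0,0; 0,0,1,0,0,0,0; 0,0,0,1,0,0,0;
     0,0,0,0,1,0,0; 0,0,0,0,0,0,1; 0,0,0,0,0,1,0]

/-- The matrix `A` of the paper. -/
def tA : Matrix (Fin 7) (Fin 7) ℤ :=
  !![1,0,0,0,0,0,0; 0,1,0,0,0,0,0; 0,0,-1,0,0,0,1; 0,0,0,-1,0,0,1;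
     0,0,-1,-1,1,0,1; 0,0,-1,-1,0,1,1; 0,0,0,0,0,0,1]

/-- An integral involution, viewed as an element of `GL (Fin 7) ℂ`. -/
def toGL (A : Matrix (Fin 7) (Fin 7) ℤ) (h : A * A = 1) : GL (Fin 7) ℂ where
  val := A.map (Int.castRingHom ℂ)
  inv := A.map (Int.castRingHom ℂ)
  val_inv := by
    rw [← Matrix.map_mul, h]
    exact Matrix.map_one _ (by simp) (by simp)
  inv_val := by
    rw [← Matrix.map_mul, h]
    exact Matrix.map_one _ (by simp) (by simp)

def g12 : GL (Fin 7) ℂ := toGL t12 (by decide)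
def g23 : GL (Fin 7) ℂ := toGL t23 (by decide)
def g34 : GL (Fin 7) ℂ := toGL t34 (by decide)
def g56 : GL (Fin 7) ℂ := toGL t56 (by decide)
def g67 : GL (Fin 7) ℂ := toGL t67 (by decide)
def gA : GL (Fin 7) ℂ := toGL tA (by decide)

/-- The group `M ≅ W(D₆)`. -/
def Mgp : Subgroup (GL (Fin 7) ℂ) := Subgroup.closure {g12, g23, g34, g56, g67, gA}

/-- The invariance group `G_K ≅ S₆` of the function `K`. -/
def GKgp : Subgroup (GL (Fin 7) ℂ) := Subgroup.closure {g23, g34, g56, g67, gA}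

/-- The invariance group `G_L ≅ W(D₅)` of the function `L`. -/
def GLgp : Subgroup (GL (Fin 7) ℂ) := Subgroup.closure {g12, g23, g34, g67, gA}

/-- The space of right cosets `H\G`. -/
abbrev RQ {G : Type*} [Group G] (H : Subgroup G) := Quotient (QuotientGroup.rightRel H)

/-- `G` acts on the right coset space `H\G` by right multiplication;
as usual a right action of `G` is rendered as a (left) action of `Gᵐᵒᵖ`. -/
instance rqAction {G : Type*} [Group G] (H : Subgroup G) : MulAction Gᵐᵒᵖ (RQ H) where
  smul g := Quotient.map (fun x => x * g.unop) (by
    intro x y hxy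
    have h' := QuotientGroup.rightRel_apply.mp hxy
    exact QuotientGroup.rightRel_apply.mpr
      (by simpa [_root_.mul_inv_rev, mul_assoc] using h'))
  one_smul q := Quotient.inductionOn q (fun x =>
    Quotient.sound (QuotientGroup.rightRel_apply.mpr (by simp [H.one_mem])))
  mul_smul g h q := Quotient.inductionOn q (fun x =>
    Quotient.sound (QuotientGroup.rightRel_apply.mpr (by simp [_root_.mul_inv_rev, mul_assoc, H.one_mem])))

/-- The elementwise action on finite subsets of fixed cardinality. -/
instance ncardAction {G X : Type*} [Group G] [MulAction G X] (k : ℕ) :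
    MulAction G {s : Set X // s.ncard = k} where
  smul g s := ⟨g • (s : Set X), by rw [Set.ncard_smul_set]; exact s.2⟩
  one_smul s := Subtype.ext (one_smul G (s : Set X))
  mul_smul g h s := Subtype.ext (mul_smul g h (s : Set X))

/-- The right coset space `G_K\M`. -/
abbrev RCK := RQ (GKgp.subgroupOf Mgp)

/-- The right coset space `G_L\M`. -/
abbrev RCL := RQ (GLgp.subgroupOf Mgp)


/-- Simple reflections generating `M`, ordered so that the first two are the short legs of the
`D₆` diagram and the others form its chain. -/
def simpleZ : Fin 6 → Matrix (Fin 7) (Fin 7) ℤ := ![t12, t34, t23, t34 * tA, t67, t56]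

/-- The reflections `simpleZ` as elements of `GL (Fin 7) ℂ`. -/
def simple : Fin 6 → GL (Fin 7) ℂ := ![g12, g34, g23, g34 * gA, g67, g56]

theorem coe_simple (s : Fin 6) :
    (simple s : Matrix (Fin 7) (Fin 7) ℂ) = (simpleZ s).map (Int.castRingHom ℂ) := by
  fin_cases s
  exacts [rfl, rfl, rfl, (Matrix.map_mul (f := Int.castRingHom ℂ)).symm, rfl, rfl]

theorem simpleZ_mul_self : ∀ s, simpleZ s * simpleZ s = 1 := by decide +kernel

theorem coe_prod_simple (u : List (Fin 6)) :
    ((u.map simple).prod : Matrix (Fin 7) (Fin 7) ℂ)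
      = (u.map simpleZ).prod.map (Int.castRingHom ℂ) := by
  induction u with
  | nil => simp
  | cons s u ih =>
    rw [List.map_cons, List.map_cons, List.prod_cons, List.prod_cons, Units.val_mul, coe_simple,
      ih, Matrix.map_mul]

theorem prod_simple_eq_iff {u v : List (Fin 6)} :
    (u.map simple).prod = (v.map simple).prod ↔ (u.map simpleZ).prod = (v.map simpleZ).prod := by
  rw [← Units.val_inj, coe_prod_simple, coe_prod_simple]
  exact (Matrix.map_injective Int.cast_injective).eq_iff

theorem simple_mul_self (s : Fin 6) : simple s * simple s = 1 := by
  have h := (prod_simple_eq_iff (u := [s, s]) (v := [])).2 (by simpa using simpleZ_mul_self s)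
  simpa using h

theorem exists_word_of_mem_closure {T : Set (Fin 6)} {g : GL (Fin 7) ℂ}
    (hg : g ∈ Subgroup.closure (simple '' T)) :
    ∃ u : List (Fin 6), (∀ s ∈ u, s ∈ T) ∧ (u.map simple).prod = g := by
  induction hg using Subgroup.closure_induction'' with
  | mem x hx =>
    obtain ⟨s, hs, rfl⟩ := hx
    exact ⟨[s], by simpa using hs, by simp⟩
  | inv_mem x hx =>
    obtain ⟨s, hs, rfl⟩ := hx
    exact ⟨[s], by simpa using hs, by simpa using eq_inv_of_mul_eq_one_left (simple_mul_self s)⟩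
  | one => exact ⟨[], by simp, by simp⟩
  | mul x y _ _ hx hy =>
    obtain ⟨u, hu, rfl⟩ := hx
    obtain ⟨v, hv, rfl⟩ := hy
    refine ⟨u ++ v, fun s hs => ?_, by simp⟩
    exact (List.mem_append.1 hs).elim (hu s) (hv s)

theorem closure_eq_of_mul_swap {G : Type*} [Group G] {S T : Set G} {a b : G}
    (haS : a ∈ S) (haT : a ∈ T) (hS : S ⊆ insert b T) (hT : T ⊆ insert (a * b) S)
    (hbS : b ∈ S) (hbT : a * b ∈ T) : Subgroup.closure S = Subgroup.closure T := by
  apply le_antisymm <;> rw [Subgroup.closure_le]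
  · intro x hx
    rcases hS hx with rfl | hx
    · have := (Subgroup.closure T).mul_mem ((Subgroup.closure T).inv_mem
        (Subgroup.subset_closure haT)) (Subgroup.subset_closure hbT)
      simpa using this
    · exact Subgroup.subset_closure hx
  · intro x hx
    rcases hT hx with rfl | hx
    · exact (Subgroup.closure S).mul_mem (Subgroup.subset_closure haS)
        (Subgroup.subset_closure hbS)
    · exact Subgroup.subset_closure hx

theorem Mgp_eq : Mgp = Subgroup.closure (simple '' Set.univ) := by
  refine closure_eq_of_mul_swap (a := g34) (b := gA) (by simp) ⟨1, trivial, rfl⟩ ?_ ?_ (by simp)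
    ⟨3, trivial, rfl⟩
  · rintro x (rfl | rfl | rfl | rfl | rfl | rfl)
    exacts [.inr ⟨0, trivial, rfl⟩, .inr ⟨2, trivial, rfl⟩, .inr ⟨1, trivial, rfl⟩,
      .inr ⟨5, trivial, rfl⟩, .inr ⟨4, trivial, rfl⟩, .inl rfl]
  · rintro _ ⟨s, -, rfl⟩
    fin_cases s <;> simp [simple]

theorem GKgp_eq : GKgp = Subgroup.closure (simple '' {s | s ≠ 0}) := by
  refine closure_eq_of_mul_swap (a := g34) (b := gA) (by simp) ⟨1, by decide, rfl⟩ ?_ ?_ (by simp)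
    ⟨3, by decide, rfl⟩
  · rintro x (rfl | rfl | rfl | rfl | rfl)
    exacts [.inr ⟨2, by decide, rfl⟩, .inr ⟨1, by decide, rfl⟩,
      .inr ⟨5, by decide, rfl⟩, .inr ⟨4, by decide, rfl⟩, .inl rfl]
  · rintro _ ⟨s, hs, rfl⟩
    fin_cases s <;> simp [simple] at hs ⊢

theorem GLgp_eq : GLgp = Subgroup.closure (simple '' {s | s ≠ 5}) := by
  refine closure_eq_of_mul_swap (a := g34) (b := gA) (by simp) ⟨1, by decide, rfl⟩ ?_ ?_ (by simp)
    ⟨3, by decide, rfl⟩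
  · rintro x (rfl | rfl | rfl | rfl | rfl)
    exacts [.inr ⟨0, by decide, rfl⟩, .inr ⟨2, by decide, rfl⟩, .inr ⟨1, by decide, rfl⟩,
      .inr ⟨4, by decide, rfl⟩, .inl rfl]
  · rintro _ ⟨s, hs, rfl⟩
    fin_cases s <;> simp [simple] at hs ⊢

/-- The reflections `simple` as elements of `M`. -/
def simpleM (s : Fin 6) : Mgp :=
  ⟨simple s, Mgp_eq ▸ Subgroup.subset_closure ⟨s, trivial, rfl⟩⟩

theorem coe_prod_simpleM (u : List (Fin 6)) :
    ((u.map simpleM).prod : GL (Fin 7) ℂ) = (u.map simple).prod := by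
  rw [SubmonoidClass.coe_list_prod, List.map_map]
  rfl

theorem exists_word (g : Mgp) : ∃ u : List (Fin 6), (u.map simpleM).prod = g := by
  obtain ⟨u, -, hu⟩ := exists_word_of_mem_closure (Mgp_eq.le g.2)
  exact ⟨u, Subtype.ext ((coe_prod_simpleM u).trans hu)⟩

/-- The result of letting the letters of a word act successively on a point. -/
def run {α : Type*} (act : Fin 6 → α → α) (x : α) (u : List (Fin 6)) : α :=
  u.foldl (fun x s => act s x) x

theorem row_run {α : Type*} {act : Fin 6 → α → α} {row : α → Fin 7 → ℤ}
    (hrow : ∀ s x, row (act s x) = row x ᵥ* simpleZ s) (x : α) (u : List (Fin 6)) :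
    row (run act x u) = row x ᵥ* (u.map simpleZ).prod := by
  induction u generalizing x with
  | nil => simp [run]
  | cons s u ih =>
    rw [List.map_cons, List.prod_cons, ← Matrix.vecMul_vecMul, ← hrow, ← ih]
    rfl

/-- The signed permutation action on `±e₁, …, ±e₆`, with `-e` numbered `11 - y` when `e` is
numbered `y`. -/
def actY (s : Fin 6) : Fin 12 → Fin 12 :=
  (![Equiv.swap 4 6 * Equiv.swap 5 7, Equiv.swap 4 5 * Equiv.swap 6 7,
    Equiv.swap 3 4 * Equiv.swap 7 8, Equiv.swap 2 3 * Equiv.swap 8 9,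
    Equiv.swap 1 2 * Equiv.swap 9 10, Equiv.swap 0 1 * Equiv.swap 10 11] :
    Fin 6 → Equiv.Perm (Fin 12)) s

/-- The orbit of a row vector fixed by `G_L`, numbered compatibly with `actY`. -/
def rowY : Fin 12 → Fin 7 → ℤ :=
  ![![0, 0, 0, 0, 1, -1, -1], ![0, 0, 0, 0, -1, 1, -1], ![0, 0, 0, 0, -1, -1, 1],
    ![0, 0, 2, 2, -1, -1, -1], ![0, 2, 0, 2, -1, -1, -1], ![0, 2, 2, 0, -1, -1, -1],
    ![2, 0, 0, 2, -1, -1, -1], ![2, 0, 2, 0, -1, -1, -1], ![2, 2, 0, 0, -1, -1, -1],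
    ![2, 2, 2, 2, -1, -1, -3], ![2, 2, 2, 2, -1, -3, -1], ![2, 2, 2, 2, -3, -1, -1]]

theorem rowY_actY : ∀ s y, rowY (actY s y) = rowY y ᵥ* simpleZ s := by decide +kernel

theorem rowY_injective : Function.Injective rowY := by
  have h : ∀ y z, rowY y = rowY z → y = z := by decide +kernel
  exact fun y z => h y z

/-- Four times the left inverse of the first seven rows of `rowY`. -/
def rowYInv : Matrix (Fin 7) (Fin 7) ℤ :=
  !![-1, -1, -1, -1, -1, 1, 2; -1, -1, -1, -1, 1, 1, 0; -1, -1, -1, 1, -1, 1, 0;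
     -1, -1, -1, 1, 1, -1, 0; 0, -2, -2, 0, 0, 0, 0; -2, 0, -2, 0, 0, 0, 0;
     -2, -2, 0, 0, 0, 0, 0]

theorem rowYInv_mul : rowYInv * Matrix.of (fun i : Fin 7 => rowY (i.castLE (by norm_num)))
    = (4 : ℤ) • (1 : Matrix (Fin 7) (Fin 7) ℤ) := by decide +kernel

/-- `M` acts faithfully on the twelve points, so words can be compared there. -/
theorem prod_eq_of_run_eq {u v : List (Fin 6)} (h : ∀ y, run actY y u = run actY y v) :
    (u.map simpleM).prod = (v.map simpleM).prod := by
  have hmul : Matrix.of (fun i : Fin 7 => rowY (i.castLE (by norm_num))) * (u.map simpleZ).prod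
      = Matrix.of (fun i : Fin 7 => rowY (i.castLE (by norm_num))) * (v.map simpleZ).prod := by
    refine funext fun i => ?_
    have hrun := fun w => row_run rowY_actY (i.castLE (by norm_num : 7 ≤ 12)) w
    rw [Matrix.mul_apply_eq_vecMul, Matrix.mul_apply_eq_vecMul]
    exact (hrun u).symm.trans ((congrArg rowY (h _)).trans (hrun v))
  have h4 := congrArg (rowYInv * ·) hmul
  simp only [← mul_assoc, rowYInv_mul, smul_mul_assoc, one_mul] at h4
  refine Subtype.ext ?_
  rw [coe_prod_simpleM, coe_prod_simpleM, prod_simple_eq_iff]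
  exact smul_right_injective _ (by norm_num) h4

/-- A word leading from `0` to `x`, found by repeatedly applying a letter that lowers `x`, at most
`k` times. -/
def descentWord {n : ℕ} (act : Fin 6 → Fin n → Fin n) : ℕ → Fin n → List (Fin 6)
  | 0, _ => []
  | k + 1, x =>
    match (List.finRange 6).find? (fun s => act s x < x) with
    | none => []
    | some s => descentWord act k (act s x) ++ [s]

theorem smul_mk {G : Type*} [Group G] (H : Subgroup G) (g x : G) :
    MulOpposite.op g • (Quotient.mk _ x : RQ H) = Quotient.mk _ (x * g) := rfl

/-- A coset space of the subgroup generated by all simple reflections but the one numbered `J`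
is described by an explicit action on `Fin (n + 1)`. -/
theorem exists_coset_equiv {n : ℕ} (act : Fin 6 → Fin (n + 1) → Fin (n + 1))
    (row : Fin (n + 1) → Fin 7 → ℤ) (word : Fin (n + 1) → List (Fin 6)) (J : Fin 6)
    (hrow : ∀ s x, row (act s x) = row x ᵥ* simpleZ s) (hinj : Function.Injective row)
    (hfix : ∀ s ≠ J, act s 0 = 0) (hword : ∀ x, run act 0 (word x) = x) (h0 : word 0 = [])
    (hschreier : ∀ s x, (∀ y, run actY y (word x ++ [s]) = run actY y (word (act s x))) ∨
      ∃ j ≠ J, ∀ y, run actY y (word x ++ [s]) = run actY y (j :: word (act s x)))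
    (H : Subgroup (GL (Fin 7) ℂ)) (hH : H = Subgroup.closure (simple '' {s | s ≠ J})) :
    ∃ F : Fin (n + 1) ≃ RQ (H.subgroupOf Mgp),
      ∀ s x, F (act s x) = MulOpposite.op (simpleM s) • F x := by
  set F : Fin (n + 1) → RQ (H.subgroupOf Mgp) :=
    fun x => Quotient.mk _ ((word x).map simpleM).prod with hF
  have hequiv : ∀ s x, F (act s x) = MulOpposite.op (simpleM s) • F x := by
    intro s x
    rw [hF, smul_mk]
    refine Quotient.sound (QuotientGroup.rightRel_apply.2 ?_)
    rcases hschreier s x with h | ⟨j, hj, h⟩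
    · have := prod_eq_of_run_eq h
      simp only [List.map_append, List.prod_append, List.map_singleton,
        List.prod_singleton] at this
      rw [this, mul_inv_cancel]
      exact one_mem _
    · have := prod_eq_of_run_eq h
      simp only [List.map_append, List.prod_append, List.map_cons, List.map_nil, List.prod_cons,
        List.prod_nil, mul_one] at this
      rw [this, mul_inv_cancel_right, Subgroup.mem_subgroupOf, hH]
      exact Subgroup.subset_closure ⟨j, hj, rfl⟩
  refine ⟨Equiv.ofBijective F ⟨fun x x' h => ?_, fun q => ?_⟩, hequiv⟩
  · have h := QuotientGroup.rightRel_apply.1 (Quotient.exact h)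
    rw [Subgroup.mem_subgroupOf, hH] at h
    obtain ⟨u, hu, hprod⟩ := exists_word_of_mem_closure h
    have hfixed : run act 0 u = 0 := by
      clear hprod
      induction u with
      | nil => rfl
      | cons s u ih =>
        have := ih fun t ht => hu t (List.mem_cons_of_mem _ ht)
        rwa [run, List.foldl_cons, hfix s (hu s List.mem_cons_self)]
    have hprod' : ((word x').map simple).prod = ((u ++ word x).map simple).prod := by
      rw [List.map_append, List.prod_append, hprod, ← coe_prod_simpleM, ← coe_prod_simpleM]
      simp
    apply hinj
    rw [← hword x, ← hword x', row_run hrow, row_run hrow 0 (word x'),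
      prod_simple_eq_iff.1 hprod', List.map_append, List.prod_append, ← Matrix.vecMul_vecMul,
      ← row_run hrow 0 u, hfixed]
  · induction q using Quotient.inductionOn with
    | h g =>
      obtain ⟨u, rfl⟩ := exists_word g
      refine ⟨run act 0 u, ?_⟩
      induction u using List.reverseRecOn with
      | nil => simp [hF, run, h0]
      | append_singleton u s ih =>
        rw [run, List.foldl_append, List.foldl_cons, List.foldl_nil, hequiv]
        refine (congrArg (MulOpposite.op (simpleM s) • ·) ih).trans ?_
        simp [smul_mk]

theorem exists_equiv_RCL : ∃ F : Fin 12 ≃ RCL,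
    ∀ s y, F (actY s y) = MulOpposite.op (simpleM s) • F y :=
  exists_coset_equiv actY rowY (descentWord actY 10) 5 rowY_actY rowY_injective
    (by decide +kernel) (by decide +kernel) (by decide +kernel) (by decide +kernel) _ GLgp_eq

/-- The signs (as bits, the sixth coordinate first) of the `a`-th vector with entries `±1` and an
even number of negative entries. -/
def signBits (a : Fin 32) : ℕ :=
  2 * a + (a ^^^ (a >>> 1) ^^^ (a >>> 2) ^^^ (a >>> 3) ^^^ (a >>> 4) : ℕ) % 2

/-- The signed permutation action on vectors with entries `±1` and an even number of negative
entries. -/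
def actX (s : Fin 6) (a : Fin 32) : Fin 32 :=
  let c := signBits a
  let c' := if s = 0 then (if c.testBit 0 = c.testBit 1 then c ^^^ 3 else c)
    else if c.testBit (s - 1) = c.testBit s then c else c ^^^ (3 <<< (s - 1 : ℕ))
  Fin.ofNat 32 (c' / 2)

/-- Whether the `y`-th vector `±eᵢ` has positive inner product with the `a`-th sign vector. -/
def rel (y : Fin 12) (a : Fin 32) : Bool :=
  if y < 6 then !(signBits a).testBit (5 - y) else (signBits a).testBit (y - 6)

theorem rel_act : ∀ s y a, rel (actY s y) (actX s a) = rel y a := by decide +kernel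

/-- The orbit of a row vector fixed by `G_K`, numbered compatibly with `actX`. -/
def rowX (a : Fin 32) : Fin 7 → ℤ := ∑ y : Fin 12, if rel y a then rowY y else 0

theorem actY_bijective (s : Fin 6) : Function.Bijective (actY s) := Equiv.bijective _

theorem rowX_actX (s : Fin 6) (a : Fin 32) : rowX (actX s a) = rowX a ᵥ* simpleZ s := by
  rw [rowX, ← (actY_bijective s).sum_comp, rowX, Matrix.sum_vecMul]
  refine Finset.sum_congr rfl fun y _ => ?_
  rw [rel_act, rowY_actY]
  split <;> simp

theorem rowX_injective : Function.Injective rowX := by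
  have h : ∀ a b, rowX a = rowX b → a = b := by decide +kernel
  exact fun a b => h a b

theorem exists_equiv_RCK : ∃ F : Fin 32 ≃ RCK,
    ∀ s a, F (actX s a) = MulOpposite.op (simpleM s) • F a :=
  exists_coset_equiv actX rowX (descentWord actX 15) 0 rowX_actX rowX_injective
    (by decide +kernel) (by decide +kernel) (by decide +kernel) (by decide +kernel) _ GKgp_eq

/-- The number of coordinates in which two sign vectors differ. -/
def dist (a b : Fin 32) : ℕ :=
  (List.range 6).countP (signBits a ^^^ signBits b).testBit

theorem dist_act : ∀ s a b, dist (actX s a) (actX s b) = dist a b := by decide +kernel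

theorem dist_comm (a b : Fin 32) : dist a b = dist b a := by
  rw [dist, dist, Nat.xor_comm]

theorem actX_injective (s : Fin 6) : Function.Injective (actX s) := by
  have h : ∀ s a, actX s (actX s a) = a := by decide +kernel
  exact Function.LeftInverse.injective (h s)

/-- The combinatorial model of `(G_L\M) × S(K²)`, with ordered pairs. -/
abbrev Config := {t : Fin 12 × Fin 32 × Fin 32 // t.2.1 ≠ t.2.2}

/-- The action of a simple reflection on configurations. -/
def Config.step (s : Fin 6) (t : Config) : Config :=
  ⟨(actY s t.1.1, actX s t.1.2.1, actX s t.1.2.2), (actX_injective s).ne t.2⟩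

/-- Exchange of the two elements of the pair. -/
def Config.swap (t : Config) : Config := ⟨(t.1.1, t.1.2.2, t.1.2.1), t.2.symm⟩

/-- The distance of the two sign vectors, and how many of them have positive inner product with
the given `±eᵢ`. -/
def invariant (t : Fin 12 × Fin 32 × Fin 32) : ℕ × ℕ :=
  (dist t.2.1 t.2.2, (rel t.1 t.2.1).toNat + (rel t.1 t.2.2).toNat)

theorem invariant_step (s : Fin 6) (t : Config) : invariant (t.step s).1 = invariant t.1 := by
  simp [invariant, Config.step, dist_act, rel_act]

theorem invariant_swap (t : Config) : invariant t.swap.1 = invariant t.1 := by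
  simp [invariant, Config.swap, dist_comm, add_comm]

/-- Representatives of the seven orbits. -/
def canon : Fin 7 → Config :=
  ![⟨(0, 0, 1), by decide⟩, ⟨(4, 0, 1), by decide⟩, ⟨(8, 0, 1), by decide⟩,
    ⟨(0, 0, 7), by decide⟩, ⟨(10, 0, 7), by decide⟩, ⟨(2, 0, 7), by decide⟩,
    ⟨(0, 0, 31), by decide⟩]

theorem invariant_canon (i : Fin 7) : invariant (canon i).1 =
    (![(2, 2), (2, 1), (2, 0), (4, 2), (4, 0), (4, 1), (6, 1)] : Fin 7 → ℕ × ℕ) i := by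
  revert i; decide +kernel

theorem invariant_canon_injective : Function.Injective fun i => invariant (canon i).1 := by
  simp only [invariant_canon]
  decide

/-- The equivalence relation generated by the simple reflections and the exchange of the pair. -/
def Linked : Config → Config → Prop :=
  Relation.EqvGen fun t t' => t' = t.swap ∨ ∃ s, t' = t.step s

theorem linked_step (t : Config) (s : Fin 6) : Linked t (t.step s) := .rel _ _ (.inr ⟨s, rfl⟩)

theorem linked_swap (t : Config) : Linked t t.swap := .rel _ _ (.inl rfl)

theorem linked_run (t : Config) (u : List (Fin 6)) : Linked t (run Config.step t u) := by
  induction u generalizing t with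
  | nil => exact .refl _
  | cons s u ih => exact .trans _ _ _ (linked_step t s) (ih _)

theorem invariant_eq_of_linked {t t' : Config} (h : Linked t t') :
    invariant t.1 = invariant t'.1 := by
  induction h with
  | rel t t' h =>
    rcases h with rfl | ⟨s, rfl⟩
    exacts [(invariant_swap t).symm, (invariant_step s t).symm]
  | refl => rfl
  | symm _ _ _ ih => exact ih.symm
  | trans _ _ _ _ _ ih ih' => exact ih.trans ih'

/-- A word moving the sign vector `b` of a representative to `0`. -/
def returnWord : List (Fin 6) := [0, 2, 1, 3, 2, 0, 4, 3, 2, 1, 5, 4, 3, 2, 0]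

theorem canon_or_lower : ∀ (y : Fin 12) (b : Fin 32) (h : 0 ≠ b),
    (∃ i, canon i = ⟨(y, 0, b), h⟩) ∨
    (∃ i, ∃ k ∈ [1, 6, 15], canon i =
      run Config.step (Config.swap ⟨(y, 0, b), h⟩) (returnWord.take k)) ∨
    ∃ s, actX s 0 = 0 ∧ (actX s b < b ∨ actX s b = b ∧ actY s y < y) := by
  decide +kernel

theorem exists_actX_lt : ∀ a : Fin 32, a ≠ 0 → ∃ s, actX s a < a := by decide +kernel

theorem exists_linked_canon_of_zero (b : Fin 32) (y : Fin 12) (h : 0 ≠ b) :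
    ∃ i, Linked ⟨(y, 0, b), h⟩ (canon i) := by
  induction b using WellFoundedLT.induction generalizing y with
  | ind b ihb =>
    induction y using WellFoundedLT.induction with
    | ind y ihy =>
      rcases canon_or_lower y b h with ⟨i, hi⟩ | ⟨i, k, -, hi⟩ | ⟨s, hs, hlt⟩
      · exact ⟨i, hi ▸ .refl _⟩
      · exact ⟨i, hi ▸ .trans _ _ _ (linked_swap _) (linked_run _ _)⟩
      · have hstep := linked_step ⟨(y, 0, b), h⟩ s
        have hne : 0 ≠ actX s b := hs ▸ (actX_injective s).ne h
        have heq : Config.step s ⟨(y, 0, b), h⟩ = ⟨(actY s y, 0, actX s b), hne⟩ := by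
          simp [Config.step, hs]
        rw [heq] at hstep
        rcases hlt with hb | ⟨hb, hy⟩
        · obtain ⟨i, hi⟩ := ihb _ hb (actY s y) hne
          exact ⟨i, .trans _ _ _ hstep hi⟩
        · obtain ⟨i, hi⟩ := ihy _ hy
          simp only [hb] at hstep
          exact ⟨i, .trans _ _ _ hstep hi⟩

theorem exists_linked_canon (t : Config) : ∃ i, Linked t (canon i) := by
  obtain ⟨⟨y, a, b⟩, h⟩ := t
  induction a using WellFoundedLT.induction generalizing y b with
  | ind a iha =>
    rcases eq_or_ne a 0 with rfl | ha
    · exact exists_linked_canon_of_zero b y h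
    · obtain ⟨s, hs⟩ := exists_actX_lt a ha
      obtain ⟨i, hi⟩ := iha _ hs (actY s y) (actX s b) ((actX_injective s).ne h)
      exact ⟨i, .trans _ _ _ (linked_step _ s) hi⟩

theorem linked_iff (t t' : Config) : Linked t t' ↔ invariant t.1 = invariant t'.1 := by
  refine ⟨invariant_eq_of_linked, fun h => ?_⟩
  obtain ⟨i, hi⟩ := exists_linked_canon t
  obtain ⟨j, hj⟩ := exists_linked_canon t'
  obtain rfl : i = j := invariant_canon_injective <|
    (invariant_eq_of_linked hi).symm.trans (h.trans (invariant_eq_of_linked hj))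
  exact .trans _ _ _ hi (.symm _ _ hj)

theorem sum_invariant : ∀ d : ℕ × ℕ,
    {t : Config | t.1.2.1 < t.1.2.2 ∧ invariant t.1 = d}.ncard =
      ∑ a : Fin 32, ∑ b : Fin 32, if a < b ∧ dist a b = d.1 then
        ∑ y : Fin 12, if (rel y a).toNat + (rel y b).toNat = d.2 then 1 else 0 else 0 := by
  intro d
  have h : Subtype.val '' {t : Config | t.1.2.1 < t.1.2.2 ∧ invariant t.1 = d} =
      ((Finset.univ.filter fun t : Fin 12 × Fin 32 × Fin 32 =>
        t.2.1 < t.2.2 ∧ invariant t = d : Finset _) : Set (Fin 12 × Fin 32 × Fin 32)) := by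
    ext t
    rw [Finset.mem_coe, Finset.mem_filter_univ]
    exact ⟨fun ⟨_, h, h'⟩ => h' ▸ h, fun h => ⟨⟨t, h.1.ne⟩, h, rfl⟩⟩
  rw [← Set.ncard_image_of_injective _ Subtype.val_injective, h, Set.ncard_coe_finset,
    Finset.card_filter, Fintype.sum_prod_type, Finset.sum_comm, Fintype.sum_prod_type]
  refine Finset.sum_congr rfl fun a _ => Finset.sum_congr rfl fun b _ => ?_
  simp only [invariant, Prod.ext_iff, ← and_assoc, ite_and]
  split_ifs <;> simp

theorem ncard_invariant_canon (i : Fin 7) :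
    {t : Config | t.1.2.1 < t.1.2.2 ∧ invariant t.1 = invariant (canon i).1}.ncard =
      (![960, 960, 960, 480, 480, 1920, 192] : Fin 7 → ℕ) i := by
  rw [sum_invariant, invariant_canon]
  revert i
  decide +kernel

section Points

variable (FY : Fin 12 ≃ RCL) (FX : Fin 32 ≃ RCK)

/-- The point of `(G_L\M) × S(K²)` described by a configuration. -/
def point (t : Config) : RCL × {s : Set RCK // s.ncard = 2} :=
  (FY t.1.1, ⟨{FX t.1.2.1, FX t.1.2.2}, Set.ncard_pair (FX.injective.ne t.2)⟩)

theorem point_eq_iff (t t' : Config) : point FY FX t = point FY FX t' ↔ t = t' ∨ t = t'.swap := by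
  obtain ⟨⟨y, a, b⟩, h⟩ := t
  obtain ⟨⟨y', a', b'⟩, h'⟩ := t'
  simp only [point, Prod.mk.injEq, Subtype.mk.injEq, Set.pair_eq_pair_iff, FY.injective.eq_iff,
    FX.injective.eq_iff, Config.swap]
  tauto

theorem point_surjective : Function.Surjective (point FY FX) := by
  rintro ⟨q, s, hs⟩
  obtain ⟨x, y, hxy, rfl⟩ := Set.ncard_eq_two.1 hs
  exact ⟨⟨(FY.symm q, FX.symm x, FX.symm y), FX.symm.injective.ne hxy⟩, by simp [point]⟩

variable {FY FX}

theorem point_step (hY : ∀ s y, FY (actY s y) = MulOpposite.op (simpleM s) • FY y)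
    (hX : ∀ s a, FX (actX s a) = MulOpposite.op (simpleM s) • FX a) (s : Fin 6) (t : Config) :
    point FY FX (t.step s) = MulOpposite.op (simpleM s) • point FY FX t := by
  refine Prod.ext (hY s _) (Subtype.ext ?_)
  change {FX (actX s t.1.2.1), FX (actX s t.1.2.2)}
    = MulOpposite.op (simpleM s) • ({FX t.1.2.1, FX t.1.2.2} : Set RCK)
  rw [hX, hX, Set.smul_set_insert, Set.smul_set_singleton]

theorem orbit_point (hY : ∀ s y, FY (actY s y) = MulOpposite.op (simpleM s) • FY y)
    (hX : ∀ s a, FX (actX s a) = MulOpposite.op (simpleM s) • FX a) (t : Config) :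
    MulAction.orbit (↥Mgp)ᵐᵒᵖ (point FY FX t)
      = point FY FX '' {t' | invariant t'.1 = invariant t.1} := by
  apply Set.Subset.antisymm
  · rintro _ ⟨g, rfl⟩
    obtain ⟨u, hu⟩ := exists_word g.unop
    obtain rfl : g = MulOpposite.op (u.map simpleM).prod := by rw [hu, MulOpposite.op_unop]
    refine ⟨run Config.step t u, (invariant_eq_of_linked (linked_run t u)).symm, ?_⟩
    clear hu
    induction u generalizing t with
    | nil => exact (one_smul _ _).symm
    | cons s u ih =>
      change _ = _ • _
      rw [List.map_cons, List.prod_cons, MulOpposite.op_mul, mul_smul, ← point_step hY hX]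
      exact ih _
  · rintro _ ⟨t', ht', rfl⟩
    rw [← MulAction.orbit_eq_iff]
    have h := (linked_iff t' t).2 ht'
    clear ht'
    induction h with
    | rel t t' h =>
      rcases h with rfl | ⟨s, rfl⟩
      · rw [(point_eq_iff FY FX _ _).2 (.inr rfl)]
      · rw [point_step hY hX, MulAction.orbit_smul]
    | refl => rfl
    | symm _ _ _ ih => exact ih.symm
    | trans _ _ _ _ _ ih ih' => exact ih.trans ih'

theorem card_orbit_point (hY : ∀ s y, FY (actY s y) = MulOpposite.op (simpleM s) • FY y)
    (hX : ∀ s a, FX (actX s a) = MulOpposite.op (simpleM s) • FX a) (t : Config) :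
    Nat.card (MulAction.orbit (↥Mgp)ᵐᵒᵖ (point FY FX t))
      = {t' : Config | t'.1.2.1 < t'.1.2.2 ∧ invariant t'.1 = invariant t.1}.ncard := by
  have himage : point FY FX '' {t' | invariant t'.1 = invariant t.1}
      = point FY FX '' {t' | t'.1.2.1 < t'.1.2.2 ∧ invariant t'.1 = invariant t.1} := by
    refine Set.Subset.antisymm ?_ (Set.image_mono fun t' h => h.2)
    rintro _ ⟨t', ht', rfl⟩
    rcases t'.2.lt_or_gt with h | h
    · exact ⟨t', ⟨h, ht'⟩, rfl⟩
    · exact ⟨t'.swap, ⟨h, (invariant_swap t').trans ht'⟩, (point_eq_iff FY FX _ _).2 (.inr rfl)⟩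
  rw [orbit_point hY hX, himage, Nat.card_coe_set_eq, Set.InjOn.ncard_image]
  intro t₁ h₁ t₂ h₂ h
  rcases (point_eq_iff FY FX _ _).1 h with h | rfl
  · exact h
  · exact absurd h₁.1 h₂.1.not_gt

end Points

/-- The action of `M` (acting on the right) on
`(G_L\\M) × S(K²)` has exactly seven orbits, of sizes
960, 960, 960, 480, 480, 1920 and 192. -/
theorem seven_orbits_on_SLK2 :
    ∃ p : Fin 7 → RCL × {s : Set RCK // s.ncard = 2},
      (∀ i j : Fin 7, i ≠ j →
        MulAction.orbit (↥Mgp)ᵐᵒᵖ (p i) ≠ MulAction.orbit (↥Mgp)ᵐᵒᵖ (p j)) ∧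
      (∀ q : RCL × {s : Set RCK // s.ncard = 2},
        ∃ i : Fin 7, q ∈ MulAction.orbit (↥Mgp)ᵐᵒᵖ (p i)) ∧
      Nat.card (MulAction.orbit (↥Mgp)ᵐᵒᵖ (p 0)) = 960 ∧
      Nat.card (MulAction.orbit (↥Mgp)ᵐᵒᵖ (p 1)) = 960 ∧
      Nat.card (MulAction.orbit (↥Mgp)ᵐᵒᵖ (p 2)) = 960 ∧
      Nat.card (MulAction.orbit (↥Mgp)ᵐᵒᵖ (p 3)) = 480 ∧
      Nat.card (MulAction.orbit (↥Mgp)ᵐᵒᵖ (p 4)) = 480 ∧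
      Nat.card (MulAction.orbit (↥Mgp)ᵐᵒᵖ (p 5)) = 1920 ∧
      Nat.card (MulAction.orbit (↥Mgp)ᵐᵒᵖ (p 6)) = 192 := by
  obtain ⟨FY, hY⟩ := exists_equiv_RCL
  obtain ⟨FX, hX⟩ := exists_equiv_RCK
  have hcard := fun i => (card_orbit_point hY hX (canon i)).trans (ncard_invariant_canon i)
  refine ⟨fun i => point FY FX (canon i), fun i j hij h => ?_, fun q => ?_,
    hcard 0, hcard 1, hcard 2, hcard 3, hcard 4, hcard 5, hcard 6⟩
  · have hmem := h ▸ MulAction.mem_orbit_self (M := (↥Mgp)ᵐᵒᵖ) (point FY FX (canon i))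
    rw [orbit_point hY hX] at hmem
    obtain ⟨t, ht, heq⟩ := hmem
    refine hij (invariant_canon_injective (Eq.trans ?_ ht))
    rcases (point_eq_iff FY FX _ _).1 heq with rfl | rfl
    exacts [rfl, (invariant_swap _).symm]
  · obtain ⟨t, rfl⟩ := point_surjective FY FX q
    obtain ⟨i, hi⟩ := exists_linked_canon t
    refine ⟨i, ?_⟩
    rw [orbit_point hY hX]
    exact ⟨t, invariant_eq_of_linked hi, rfl⟩

end KLPaper
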